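/- There exist a real polynomial u and a real constant c > 0 such that the even Schwartz function f(x) = u(x²) e^{−x²/2} satisfies: (i) f(x) ≥ 0 for all x ≥ 3.9359; (ii) f̂(√(λ − 1/4)) ≤ c for all λ ∈ [2.575, 5.5]; (iii) f̂(√(λ − 1/4)) ≤ 0 for all λ ≥ 5.5; (iv) writing L₁ = 8·arccosh(1/2 + cos(2π/7)) and L₂ = 6·arccosh(8 cos⁴(π/7) − 6 cos²(π/7) + 1), one has (1/c) · ( 4 ∫₀^∞ ξ f̂(ξ) tanh(πξ) dξ + (1/√(2π)) ( 21·L₁·f(L₁)/sinh(L₁/2) + 28·L₂·f(L₂)/sinh(L₂/2) ) − (1/√(2π)) ∫_ℝ f(x) cosh(x/2) dx ) > 7. -/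

import Mathlib

open Real MeasureTheory

/-- The even function `x ↦ u(x²) e^{-x²/2}` associated to a real polynomial `u`. -/
noncomputable def gaussPoly (u : Polynomial ℝ) (x : ℝ) : ℝ :=
  u.eval (x ^ 2) * Real.exp (-x ^ 2 / 2)

/-- The Fourier transform `f̂(ξ) = (1/√(2π)) ∫_ℝ f(x) e^{-iξx} dx` of an even real-valued
function, written in its real form `(1/√(2π)) ∫_ℝ f(x) cos(ξ x) dx`. -/
noncomputable def evenFT (f : ℝ → ℝ) (ξ : ℝ) : ℝ :=
  (1 / Real.sqrt (2 * π)) * ∫ x : ℝ, f x * Real.cos (ξ * x)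

/-- The inverse of `cosh` mapping `[1, ∞)` to `[0, ∞)`, given by its standard
logarithmic formula. -/
noncomputable def Real.arccosh (x : ℝ) : ℝ :=
  Real.log (x + Real.sqrt (x ^ 2 - 1))

open Set

/-- Polynomial moments of a Gaussian against a complex exponential are integrable. -/
lemma integrable_pow_mul_cexp_gaussian (n : ℕ) (z : ℂ) :
    Integrable (fun x : ℝ => (x : ℂ) ^ n * Complex.exp (-(1 / 2) * (x : ℂ) ^ 2 + z * x)) := by
  have h1 : Integrable (fun x : ℝ => x ^ n * Real.exp (-(1 / 4) * x ^ 2)) := by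
    have := integrable_rpow_mul_exp_neg_mul_sq (b := 1 / 4) (by norm_num) (s := n)
      (by have : (0 : ℝ) ≤ n := n.cast_nonneg
          linarith)
    simpa only [Real.rpow_natCast] using this
  have h2 := (h1.ofReal (𝕜 := ℂ)).mul_bdd (c := Real.exp (z.re ^ 2))
    (g := fun x : ℝ => Complex.exp (-(1 / 4) * (x : ℂ) ^ 2 + z * x))
    (by fun_prop) (ae_of_all _ fun x => by
      rw [Complex.norm_exp]
      apply Real.exp_le_exp.2
      have : (-(1 / 4) * (x : ℂ) ^ 2 + z * x).re = -(1 / 4) * x ^ 2 + z.re * x := by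
        have h : (x : ℂ) ^ 2 = ((x ^ 2 : ℝ) : ℂ) := by push_cast; rfl
        rw [h]
        simp [-Complex.ofReal_pow]
      rw [this]
      nlinarith [sq_nonneg (x / 2 - z.re)])
  refine h2.congr (ae_of_all _ fun x => ?_)
  change ((x ^ n * Real.exp (-(1 / 4) * x ^ 2) : ℝ) : ℂ) * _ = _
  rw [Complex.ofReal_mul, Complex.ofReal_exp, Complex.ofReal_pow, mul_assoc, ← Complex.exp_add]
  push_cast
  congr 2
  ring

/-- Integration by parts recursion for the moments of a Gaussian against an exponential. -/
lemma integral_pow_succ_mul_cexp_gaussian (n : ℕ) (z : ℂ) :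
    ∫ x : ℝ, (x : ℂ) ^ (n + 1) * Complex.exp (-(1 / 2) * (x : ℂ) ^ 2 + z * x) =
      z * (∫ x : ℝ, (x : ℂ) ^ n * Complex.exp (-(1 / 2) * (x : ℂ) ^ 2 + z * x)) +
      n * (∫ x : ℝ, (x : ℂ) ^ (n - 1) * Complex.exp (-(1 / 2) * (x : ℂ) ^ 2 + z * x)) := by
  have I := fun m => integrable_pow_mul_cexp_gaussian m z
  have hd : ∀ x : ℝ, HasDerivAt
      (fun x : ℝ => (x : ℂ) ^ n * Complex.exp (-(1 / 2) * (x : ℂ) ^ 2 + z * x))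
      (z * ((x : ℂ) ^ n * Complex.exp (-(1 / 2) * (x : ℂ) ^ 2 + z * x)) +
        n * ((x : ℂ) ^ (n - 1) * Complex.exp (-(1 / 2) * (x : ℂ) ^ 2 + z * x)) -
        (x : ℂ) ^ (n + 1) * Complex.exp (-(1 / 2) * (x : ℂ) ^ 2 + z * x)) x := by
    intro x
    have h : HasDerivAt (fun w : ℂ => w ^ n * Complex.exp (-(1 / 2) * w ^ 2 + z * w))
        ((n * (x : ℂ) ^ (n - 1)) * Complex.exp (-(1 / 2) * (x : ℂ) ^ 2 + z * x) +
          (x : ℂ) ^ n * (Complex.exp (-(1 / 2) * (x : ℂ) ^ 2 + z * x) *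
            (-(1 / 2) * (2 * (x : ℂ)) + z))) (x : ℂ) := by
      refine (hasDerivAt_pow n (x : ℂ)).mul (HasDerivAt.cexp (HasDerivAt.add ?_ ?_))
      · simpa using (hasDerivAt_pow 2 (x : ℂ)).const_mul (-(1 / 2) : ℂ)
      · simpa using (hasDerivAt_id (x : ℂ)).const_mul z
    refine h.comp_ofReal.congr_deriv ?_
    ring
  have := integral_eq_zero_of_hasDerivAt_of_integrable hd
    ((((I n).const_mul z).add ((I (n - 1)).const_mul _)).sub (I (n + 1))) (I n)
  rw [integral_sub (((I n).const_mul z).fun_add ((I (n - 1)).const_mul _)) (I (n + 1)),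
    integral_add ((I n).const_mul z) ((I (n - 1)).const_mul _), integral_const_mul,
    integral_const_mul] at this
  exact (sub_eq_zero.1 this).symm

lemma integral_cexp_gaussian (z : ℂ) :
    ∫ x : ℝ, Complex.exp (-(1 / 2) * (x : ℂ) ^ 2 + z * x) =
      (√(2 * π) : ℝ) * Complex.exp (z ^ 2 / 2) := by
  have h := integral_cexp_quadratic (b := -(1 / 2)) (by norm_num) z 0
  simp only [add_zero] at h
  rw [h]
  congr 1
  · rw [Real.sqrt_eq_rpow, Complex.ofReal_cpow (by positivity)]
    push_cast
    congr 1
    ring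
  · congr 1
    ring

/-- The cubic whose associated even Schwartz function has Fourier transform
`(21 / 4 - ξ²) (ξ² - 59 / 5)² e^{-ξ²/2}`. -/
noncomputable def testPoly : Polynomial ℝ :=
  Polynomial.X ^ 3 + Polynomial.C (277 / 20) * Polynomial.X ^ 2 +
    Polynomial.C (3376 / 25) * Polynomial.X + Polynomial.C (26971 / 50)

lemma gaussPoly_testPoly (x : ℝ) : gaussPoly testPoly x =
    ((x ^ 2) ^ 3 + 277 / 20 * (x ^ 2) ^ 2 + 3376 / 25 * x ^ 2 + 26971 / 50) *
      Real.exp (-x ^ 2 / 2) := by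
  simp [gaussPoly, testPoly]

lemma integrable_and_integral_testPoly_mul_cexp (z : ℂ) :
    Integrable (fun x : ℝ => (gaussPoly testPoly x : ℂ) * Complex.exp (z * x)) ∧
    ∫ x : ℝ, (gaussPoly testPoly x : ℂ) * Complex.exp (z * x) =
      (√(2 * π) : ℝ) * ((21 / 4 + z ^ 2) * (z ^ 2 + 59 / 5) ^ 2 * Complex.exp (z ^ 2 / 2)) := by
  have I := fun m => integrable_pow_mul_cexp_gaussian m z
  have e : (fun x : ℝ => (gaussPoly testPoly x : ℂ) * Complex.exp (z * x)) = fun x : ℝ =>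
      ((x : ℂ) ^ 6 * Complex.exp (-(1 / 2) * (x : ℂ) ^ 2 + z * x) +
      277 / 20 * ((x : ℂ) ^ 4 * Complex.exp (-(1 / 2) * (x : ℂ) ^ 2 + z * x)) +
      3376 / 25 * ((x : ℂ) ^ 2 * Complex.exp (-(1 / 2) * (x : ℂ) ^ 2 + z * x))) +
      26971 / 50 * ((x : ℂ) ^ 0 * Complex.exp (-(1 / 2) * (x : ℂ) ^ 2 + z * x)) := by
    ext x
    rw [gaussPoly_testPoly]
    push_cast
    rw [Complex.exp_add, show -(x : ℂ) ^ 2 / 2 = -(1 / 2) * (x : ℂ) ^ 2 by ring]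
    ring
  have J4 := (I 4).const_mul (277 / 20)
  have J2 := (I 2).const_mul (3376 / 25)
  have J0 := (I 0).const_mul (26971 / 50)
  rw [e]
  refine ⟨(((I 6).add J4).add J2).add J0, ?_⟩
  rw [integral_add (((I 6).fun_add J4).fun_add J2) J0, integral_add ((I 6).fun_add J4) J2,
    integral_add (I 6) J4, integral_const_mul, integral_const_mul, integral_const_mul]
  have R := fun m => integral_pow_succ_mul_cexp_gaussian m z
  have R0 : ∫ x : ℝ, (x : ℂ) ^ 0 * Complex.exp (-(1 / 2) * (x : ℂ) ^ 2 + z * x) =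
      (√(2 * π) : ℝ) * Complex.exp (z ^ 2 / 2) := by
    simpa only [pow_zero, one_mul] using integral_cexp_gaussian z
  simp only [R 5, R 4, R 3, R 2, R 1, R 0, R0]
  push_cast
  ring

lemma integral_testPoly_mul_ccos (w : ℂ) :
    ∫ x : ℝ, (gaussPoly testPoly x : ℂ) * Complex.cos (w * x) =
      (√(2 * π) : ℝ) * ((21 / 4 - w ^ 2) * (w ^ 2 - 59 / 5) ^ 2 * Complex.exp (-w ^ 2 / 2)) := by
  obtain ⟨i1, h1⟩ := integrable_and_integral_testPoly_mul_cexp (w * Complex.I)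
  obtain ⟨i2, h2⟩ := integrable_and_integral_testPoly_mul_cexp (-(w * Complex.I))
  have e : (fun x : ℝ => (gaussPoly testPoly x : ℂ) * Complex.cos (w * x)) = fun x : ℝ =>
      1 / 2 * ((gaussPoly testPoly x : ℂ) * Complex.exp (w * Complex.I * x) +
        (gaussPoly testPoly x : ℂ) * Complex.exp (-(w * Complex.I) * x)) := by
    ext x
    rw [Complex.cos, show w * x * Complex.I = w * Complex.I * x by ring,
      show -(w * x) * Complex.I = -(w * Complex.I) * x by ring]
    ring
  rw [e, integral_const_mul, integral_add i1 i2, h1, h2]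
  simp only [neg_sq, mul_pow, Complex.I_sq]
  rw [show w ^ 2 * -1 / 2 = -w ^ 2 / 2 by ring]
  ring

lemma evenFT_testPoly (ξ : ℝ) : evenFT (gaussPoly testPoly) ξ =
    (21 / 4 - ξ ^ 2) * (ξ ^ 2 - 59 / 5) ^ 2 * Real.exp (-ξ ^ 2 / 2) := by
  have h : ∫ x : ℝ, gaussPoly testPoly x * Real.cos (ξ * x) =
      √(2 * π) * ((21 / 4 - ξ ^ 2) * (ξ ^ 2 - 59 / 5) ^ 2 * Real.exp (-ξ ^ 2 / 2)) := by
    rw [← Complex.ofReal_inj, ← integral_complex_ofReal]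
    push_cast
    exact integral_testPoly_mul_ccos ξ
  have hp : √(2 * π) ≠ 0 := by positivity
  rw [evenFT, h]
  field_simp

lemma integral_testPoly_cosh : ∫ x : ℝ, gaussPoly testPoly x * Real.cosh (x / 2) =
    √(2 * π) * (11 / 2 * (241 / 20) ^ 2 * Real.exp (1 / 8)) := by
  rw [← Complex.ofReal_inj, ← integral_complex_ofReal]
  have h := integral_testPoly_mul_ccos (Complex.I / 2)
  have e : ∀ x : ℝ, Complex.cos (Complex.I / 2 * x) = Complex.cosh (x / 2) := fun x => by
    rw [← Complex.cos_mul_I]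
    congr 1
    ring
  simp only [e] at h
  push_cast
  rw [h, div_pow, Complex.I_sq]
  norm_num

lemma integrableOn_pow_mul_exp_neg_mul (m : ℕ) {a : ℝ} (ha : 0 < a) :
    IntegrableOn (fun x : ℝ => x ^ m * Real.exp (-(a * x))) (Ioi 0) := by
  have := integrableOn_rpow_mul_exp_neg_mul_rpow (p := 1) (s := m) (b := a)
    (by have : (0 : ℝ) ≤ m := m.cast_nonneg
        linarith) one_pos ha
  simpa only [Real.rpow_natCast, Real.rpow_one, neg_mul] using this

lemma integral_pow_mul_exp_neg_mul (m : ℕ) {a : ℝ} (ha : 0 < a) :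
    ∫ x in Ioi (0 : ℝ), x ^ m * Real.exp (-(a * x)) = m.factorial / a ^ (m + 1) := by
  have := Real.integral_rpow_mul_exp_neg_mul_Ioi (a := m + 1) (r := a) (by positivity) ha
  simp only [add_sub_cancel_right, Real.rpow_natCast] at this
  rw [this, Real.Gamma_nat_eq_factorial, ← Nat.cast_succ, Real.rpow_natCast, one_div,
    inv_pow, Nat.succ_eq_add_one, inv_mul_eq_div]

lemma integrable_pow_mul_exp_neg_sq_div_two (n : ℕ) :
    Integrable (fun x : ℝ => x ^ n * Real.exp (-x ^ 2 / 2)) := by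
  have := integrable_rpow_mul_exp_neg_mul_sq (b := 1 / 2) (by norm_num) (s := n)
    (by have : (0 : ℝ) ≤ n := n.cast_nonneg
        linarith)
  simp only [Real.rpow_natCast] at this
  refine this.congr (ae_of_all _ fun x => ?_)
  ring_nf

lemma integral_mul_evenFT_testPoly :
    IntegrableOn (fun ξ => ξ * evenFT (gaussPoly testPoly) ξ) (Ioi 0) ∧
    ∫ ξ in Ioi (0 : ℝ), ξ * evenFT (gaussPoly testPoly) ξ = 38753 / 100 := by
  have I := fun m => integrable_pow_mul_exp_neg_sq_div_two m
  have i1 : Integrable (fun ξ => ξ * evenFT (gaussPoly testPoly) ξ) := by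
    refine ((((I 7).const_mul (-1)).fun_add ((I 5).const_mul (577 / 20))).fun_add
      (((I 3).const_mul (-(13157 / 50))).fun_add ((I 1).const_mul (73101 / 100)))).congr
      (ae_of_all _ fun ξ => ?_)
    simp only [evenFT_testPoly]
    ring
  have i2 : Integrable (fun ξ : ℝ => (ξ ^ 6 - 457 / 20 * ξ ^ 4 + 8587 / 50 * ξ ^ 2 - 38753 / 100) *
      Real.exp (-ξ ^ 2 / 2)) := by
    refine (((I 6).fun_add ((I 4).const_mul (-(457 / 20)))).fun_add
      (((I 2).const_mul (8587 / 50)).fun_add ((I 0).const_mul (-(38753 / 100))))).congr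
      (ae_of_all _ fun ξ => ?_)
    ring_nf
  have hd : ∀ ξ : ℝ, HasDerivAt (fun ξ : ℝ =>
      (ξ ^ 6 - 457 / 20 * ξ ^ 4 + 8587 / 50 * ξ ^ 2 - 38753 / 100) * Real.exp (-ξ ^ 2 / 2))
      (ξ * evenFT (gaussPoly testPoly) ξ) ξ := by
    intro ξ
    have h1 : HasDerivAt (fun ξ : ℝ => ξ ^ 6 - 457 / 20 * ξ ^ 4 + 8587 / 50 * ξ ^ 2 - 38753 / 100)
        (6 * ξ ^ 5 - 457 / 20 * (4 * ξ ^ 3) + 8587 / 50 * (2 * ξ)) ξ := by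
      have := ((((hasDerivAt_pow 6 ξ).sub ((hasDerivAt_pow 4 ξ).const_mul (457 / 20))).add
        ((hasDerivAt_pow 2 ξ).const_mul (8587 / 50))).sub_const (38753 / 100))
      simpa using this
    have h2 : HasDerivAt (fun ξ : ℝ => -ξ ^ 2 / 2) (-ξ) ξ := by
      refine ((hasDerivAt_pow 2 ξ).neg.div_const 2).congr_deriv ?_
      norm_num
      ring
    refine (h1.mul h2.exp).congr_deriv ?_
    rw [evenFT_testPoly]
    ring
  refine ⟨i1.integrableOn, ?_⟩
  rw [integral_Ioi_of_hasDerivAt_of_tendsto' (m := 0) (fun ξ _ => hd ξ) i1.integrableOn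
    (tendsto_zero_of_hasDerivAt_of_integrableOn_Ioi (fun ξ _ => hd ξ) i1.integrableOn
      i2.integrableOn (a := 0))]
  norm_num

lemma evenFT_testPoly_le (ξ : ℝ) : evenFT (gaussPoly testPoly) ξ ≤
    73101 / 100 - 125729 / 200 * ξ ^ 2 + 252 * ξ ^ 4 := by
  rw [evenFT_testPoly, show ξ ^ 4 = (ξ ^ 2) ^ 2 by ring]
  have ht : 0 ≤ ξ ^ 2 := sq_nonneg ξ
  generalize ξ ^ 2 = t at ht
  have hP : 0 ≤ 73101 / 100 - 125729 / 200 * t + 252 * t ^ 2 := by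
    nlinarith [sq_nonneg (t - 5 / 4)]
  rcases le_total (21 / 4) t with h | h
  · refine le_trans ?_ hP
    have : 0 ≤ (t - 21 / 4) * (t - 59 / 5) ^ 2 * Real.exp (-t / 2) := by
      have : 0 ≤ t - 21 / 4 := by linarith
      positivity
    linarith
  · have he : 1 + t / 2 + t ^ 2 / 8 + t ^ 3 / 48 ≤ Real.exp (t / 2) := by
      have := Real.sum_le_exp_of_nonneg (x := t / 2) (by positivity) 4
      norm_num [Finset.sum_range_succ, Nat.factorial] at this
      linarith
    have hprod : Real.exp (t / 2) * Real.exp (-t / 2) = 1 := by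
      rw [← Real.exp_add]
      ring_nf
      exact Real.exp_zero
    have hg : (21 / 4 - t) * (t - 59 / 5) ^ 2 ≤
        (73101 / 100 - 125729 / 200 * t + 252 * t ^ 2) * Real.exp (t / 2) := by
      refine le_trans ?_ (mul_le_mul_of_nonneg_left he hP)
      have h2 := pow_nonneg ht 2
      have h3 := pow_nonneg ht 3
      have h4 := pow_nonneg ht 4
      have h5 := pow_nonneg ht 5
      nlinarith
    calc _ ≤ (73101 / 100 - 125729 / 200 * t + 252 * t ^ 2) * Real.exp (t / 2) *
          Real.exp (-t / 2) := mul_le_mul_of_nonneg_right hg (Real.exp_pos _).le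
      _ = _ := by rw [mul_assoc, hprod, mul_one]

/-- An upper bound for `1 - tanh` by a truncated geometric series. -/
lemma one_sub_tanh_le {y : ℝ} (hy : 0 ≤ y) :
    1 - Real.tanh y ≤ 2 * (Real.exp (-(2 * y)) - Real.exp (-(2 * y)) ^ 2 +
      Real.exp (-(2 * y)) ^ 3 - Real.exp (-(2 * y)) ^ 4 + Real.exp (-(2 * y)) ^ 5 -
      Real.exp (-(2 * y)) ^ 6 / 2) := by
  have hq1 : Real.exp (-(2 * y)) ≤ 1 := Real.exp_le_one_iff.2 (by linarith)
  have hq0 := Real.exp_pos (-(2 * y))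
  have ht : 1 - Real.tanh y = 2 * Real.exp (-(2 * y)) / (1 + Real.exp (-(2 * y))) := by
    rw [Real.tanh_eq, show -(2 * y) = -y + -y by ring, Real.exp_add]
    have h : Real.exp y * Real.exp (-y) = 1 := by rw [← Real.exp_add]; simp
    have := Real.exp_pos y
    have := Real.exp_pos (-y)
    field_simp
    linear_combination -2 * Real.exp (-y) * h
  rw [ht]
  generalize Real.exp (-(2 * y)) = q at hq0 hq1
  rw [div_le_iff₀ (by positivity)]
  have : 0 ≤ q ^ 6 * (1 - q) := mul_nonneg (by positivity) (by linarith)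
  nlinarith

lemma integral_quintic_mul_exp_neg_mul {a : ℝ} (ha : 0 < a) :
    IntegrableOn (fun ξ : ℝ => ξ * (73101 / 100 - 125729 / 200 * ξ ^ 2 + 252 * ξ ^ 4) *
      Real.exp (-(a * ξ))) (Ioi 0) ∧
    ∫ ξ in Ioi (0 : ℝ), ξ * (73101 / 100 - 125729 / 200 * ξ ^ 2 + 252 * ξ ^ 4) *
      Real.exp (-(a * ξ)) =
      73101 / 100 / a ^ 2 - 125729 / 200 * 6 / a ^ 4 + 252 * 120 / a ^ 6 := by
  have I := fun m => integrableOn_pow_mul_exp_neg_mul m ha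
  have e : (fun ξ : ℝ => ξ * (73101 / 100 - 125729 / 200 * ξ ^ 2 + 252 * ξ ^ 4) *
      Real.exp (-(a * ξ))) = fun ξ => 73101 / 100 * (ξ ^ 1 * Real.exp (-(a * ξ))) -
      125729 / 200 * (ξ ^ 3 * Real.exp (-(a * ξ))) + 252 * (ξ ^ 5 * Real.exp (-(a * ξ))) := by
    ext ξ
    ring
  have I1 := (I 1).const_mul (73101 / 100)
  have I3 := (I 3).const_mul (125729 / 200)
  have I5 := (I 5).const_mul 252
  rw [e]
  refine ⟨(I1.sub I3).add I5, ?_⟩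
  rw [integral_add (by exact I1.sub I3) I5, integral_sub I1 I3, integral_const_mul,
    integral_const_mul, integral_const_mul, integral_pow_mul_exp_neg_mul 1 ha,
    integral_pow_mul_exp_neg_mul 3 ha, integral_pow_mul_exp_neg_mul 5 ha]
  norm_num [Nat.factorial]
  ring

lemma integral_evenFT_testPoly_tanh :
    1442 / 4 ≤ ∫ ξ in Ioi (0 : ℝ), ξ * evenFT (gaussPoly testPoly) ξ * Real.tanh (π * ξ) := by
  obtain ⟨i0, h0⟩ := integral_mul_evenFT_testPoly
  have hpi := Real.pi_pos
  have M := fun n : ℕ => integral_quintic_mul_exp_neg_mul (a := 2 * π * (n + 1)) (by positivity)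
  set P : ℝ → ℝ := fun ξ => ξ * (73101 / 100 - 125729 / 200 * ξ ^ 2 + 252 * ξ ^ 4) with hP
  let w : ℕ → ℝ := fun n => if n = 5 then -1 / 2 else (-1) ^ n
  have iR : IntegrableOn (fun ξ => ∑ n ∈ Finset.range 6,
      2 * w n * (P ξ * Real.exp (-(2 * π * (n + 1) * ξ)))) (Ioi 0) :=
    integrable_finsetSum _ fun n _ => (M n).1.const_mul _
  have hR : ∫ ξ in Ioi (0 : ℝ), ∑ n ∈ Finset.range 6,
      2 * w n * (P ξ * Real.exp (-(2 * π * (n + 1) * ξ))) ≤ 27 := by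
    rw [integral_finsetSum _ fun n _ => (M n).1.const_mul _]
    simp only [integral_const_mul, (M _).2]
    have hx1 : 0.10131 ≤ 1 / π ^ 2 := by
      rw [le_div_iff₀ (by positivity)]
      nlinarith [Real.pi_lt_d4]
    have hx2 : 1 / π ^ 2 ≤ 0.10134 := by
      rw [div_le_iff₀ (by positivity)]
      nlinarith [Real.pi_gt_d4]
    have e2 : ∀ n : ℝ, 1 / (2 * π * n) ^ 2 = 1 / π ^ 2 * (1 / (2 * n) ^ 2) := fun n => by ring
    have e (n : ℝ) : 73101 / 100 / (2 * π * n) ^ 2 - 125729 / 200 * 6 / (2 * π * n) ^ 4 +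
        252 * 120 / (2 * π * n) ^ 6 = 73101 / 100 * (1 / (2 * n) ^ 2) * (1 / π ^ 2) -
        125729 / 200 * 6 * (1 / (2 * n) ^ 4) * (1 / π ^ 2) ^ 2 +
        252 * 120 * (1 / (2 * n) ^ 6) * (1 / π ^ 2) ^ 3 := by ring
    simp only [e]
    generalize 1 / π ^ 2 = x at hx1 hx2
    have hx3 : 0.10131 ^ 2 ≤ x ^ 2 := by gcongr
    have hx4 : x ^ 3 ≤ 0.10134 ^ 3 := by gcongr
    norm_num [Finset.sum_range_succ, w] at hx1 hx2 hx3 hx4 ⊢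
    linarith
  have hpt : ∀ ξ ∈ Ioi (0 : ℝ), ξ * evenFT (gaussPoly testPoly) ξ - ∑ n ∈ Finset.range 6,
      2 * w n * (P ξ * Real.exp (-(2 * π * (n + 1) * ξ))) ≤
      ξ * evenFT (gaussPoly testPoly) ξ * Real.tanh (π * ξ) := by
    intro ξ hξ
    have hξ' : 0 < ξ := hξ
    have hf : ξ * evenFT (gaussPoly testPoly) ξ ≤ P ξ :=
      mul_le_mul_of_nonneg_left (evenFT_testPoly_le ξ) hξ'.le
    have hP0 : 0 ≤ P ξ :=
      mul_nonneg hξ'.le (by nlinarith [sq_nonneg (ξ ^ 2 - 5 / 4)])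
    have hS : ∑ n ∈ Finset.range 6, 2 * w n * (P ξ * Real.exp (-(2 * π * (n + 1) * ξ))) =
        P ξ * (2 * (Real.exp (-(2 * (π * ξ))) - Real.exp (-(2 * (π * ξ))) ^ 2 +
        Real.exp (-(2 * (π * ξ))) ^ 3 - Real.exp (-(2 * (π * ξ))) ^ 4 +
        Real.exp (-(2 * (π * ξ))) ^ 5 - Real.exp (-(2 * (π * ξ))) ^ 6 / 2)) := by
      have e : ∀ n : ℕ, Real.exp (-(2 * π * (n + 1) * ξ)) =
          Real.exp (-(2 * (π * ξ))) ^ (n + 1) := fun n => by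
        rw [← Real.exp_nat_mul]
        push_cast
        ring_nf
      simp only [e]
      norm_num [Finset.sum_range_succ, w]
      ring
    have h1 := one_sub_tanh_le (y := π * ξ) (by positivity)
    have h2 : 0 ≤ 1 - Real.tanh (π * ξ) := sub_nonneg.2 (Real.tanh_lt_one _).le
    rw [hS]
    have := mul_le_mul_of_nonneg_left h1 hP0
    have := mul_le_mul_of_nonneg_right hf h2
    linarith
  have iT : IntegrableOn (fun ξ => ξ * evenFT (gaussPoly testPoly) ξ * Real.tanh (π * ξ))
      (Ioi 0) := by
    refine Integrable.mul_bdd (c := 1) i0 ?_ (ae_of_all _ fun ξ => ?_)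
    · simp only [Real.tanh_eq_sinh_div_cosh]
      exact (Continuous.div (by fun_prop) (by fun_prop)
        fun ξ => (Real.cosh_pos _).ne').aestronglyMeasurable
    · exact (Real.abs_tanh_lt_one _).le
  have := setIntegral_mono_on (i0.sub iR) iT measurableSet_Ioi hpt
  simp only [Pi.sub_apply] at this
  rw [integral_sub i0 iR, h0] at this
  linarith

lemma minpoly_cos_two_pi_div_seven :
    8 * Real.cos (2 * π / 7) ^ 3 + 4 * Real.cos (2 * π / 7) ^ 2 - 4 * Real.cos (2 * π / 7) - 1
      = 0 := by
  have hpi := Real.pi_pos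
  have h1 : Real.cos (2 * π / 7) < 1 := by
    rw [← Real.cos_zero]
    exact Real.cos_lt_cos_of_nonneg_of_le_pi le_rfl (by linarith) (by linarith)
  have h : Real.cos (2 * (2 * (2 * π / 7))) = Real.cos (3 * (2 * π / 7)) := by
    rw [← Real.cos_two_pi_sub]
    congr 1
    ring
  rw [Real.cos_three_mul, Real.cos_two_mul, Real.cos_two_mul] at h
  generalize Real.cos (2 * π / 7) = c at h h1
  refine (mul_eq_zero.1 (?_ : (c - 1) * _ = 0)).resolve_left (by linarith)
  linear_combination h

lemma cos_two_pi_div_seven_mem : Real.cos (2 * π / 7) ∈ Icc (0.62345 : ℝ) 0.62353 := by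
  have hpi := Real.pi_pos
  have h1 : 1 / 2 < Real.cos (2 * π / 7) := by
    rw [← Real.cos_pi_div_three]
    exact Real.cos_lt_cos_of_nonneg_of_le_pi (by linarith) (by linarith) (by linarith)
  have h := minpoly_cos_two_pi_div_seven
  generalize Real.cos (2 * π / 7) = c at h h1
  constructor
  · by_contra! hc
    nlinarith [mul_pos (sub_pos.2 hc) (sub_pos.2 h1),
      mul_pos (mul_pos (sub_pos.2 hc) (sub_pos.2 h1)) (sub_pos.2 h1)]
  · by_contra! hc
    nlinarith [mul_pos (sub_pos.2 hc) (sub_pos.2 h1),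
      mul_pos (mul_pos (sub_pos.2 hc) (sub_pos.2 h1)) (sub_pos.2 h1)]

lemma systole_mem :
    8 * Real.arccosh (1 / 2 + Real.cos (2 * π / 7)) ∈ Icc (3.935 : ℝ) 3.937 := by
  obtain ⟨h1, h2⟩ := cos_two_pi_div_seven_mem
  generalize Real.cos (2 * π / 7) = c at h1 h2
  have s1 : 0.51199 ≤ √((1 / 2 + c) ^ 2 - 1) := Real.le_sqrt_of_sq_le (by nlinarith)
  have s2 : √((1 / 2 + c) ^ 2 - 1) ≤ 0.5122 := Real.sqrt_le_iff.2 ⟨by norm_num, by nlinarith⟩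
  have e1 : Real.exp 0.491875 ≤ 1.63539 := by
    refine (Real.exp_bound' (n := 8) (by norm_num) (by norm_num) (by norm_num)).trans ?_
    norm_num [Finset.sum_range_succ, Nat.factorial]
  have e2 : 1.63578 ≤ Real.exp 0.492125 := by
    refine le_trans ?_ (Real.sum_le_exp_of_nonneg (by norm_num) 8)
    norm_num [Finset.sum_range_succ, Nat.factorial]
  rw [Real.arccosh]
  have l1 : 0.491875 ≤ Real.log (1 / 2 + c + √((1 / 2 + c) ^ 2 - 1)) :=
    (Real.le_log_iff_exp_le (by linarith)).2 (by linarith)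
  have l2 : Real.log (1 / 2 + c + √((1 / 2 + c) ^ 2 - 1)) ≤ 0.492125 :=
    (Real.log_le_iff_le_exp (by linarith)).2 (by linarith)
  constructor <;> linarith

lemma exp_neg_one_point_le : Real.exp (-1.1625) ≤ 0.31271 := by
  have h : 1.78826 ≤ Real.exp 0.58125 := by
    refine le_trans ?_ (Real.sum_le_exp_of_nonneg (by norm_num) 9)
    norm_num [Finset.sum_range_succ, Nat.factorial]
  rw [show (-1.1625 : ℝ) = -(0.58125 + 0.58125) by norm_num, Real.exp_neg, Real.exp_add]
  refine inv_le_of_inv_le₀ (by norm_num) ?_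
  nlinarith

lemma exp_one_eighth_le : Real.exp (1 / 8) ≤ 1.13315 := by
  refine (Real.exp_bound' (n := 6) (by norm_num) (by norm_num) (by norm_num)).trans ?_
  norm_num [Finset.sum_range_succ, Nat.factorial]

lemma gaussPoly_testPoly_nonneg (x : ℝ) : 0 ≤ gaussPoly testPoly x := by
  rw [gaussPoly_testPoly]
  positivity

lemma mul_div_sinh_half_nonneg (L : ℝ) {y : ℝ} (hy : 0 ≤ y) :
    0 ≤ 28 * L * y / Real.sinh (L / 2) := by
  rcases le_total 0 L with h | h
  · have := Real.sinh_nonneg_iff.2 (by linarith : 0 ≤ L / 2)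
    positivity
  · refine div_nonneg_of_nonpos ?_ (Real.sinh_nonpos_iff.2 (by linarith))
    nlinarith

lemma systole_term_ge {L : ℝ} (h1 : 3.935 ≤ L) (h2 : L ≤ 3.937) :
    38.9 ≤ 1 / √(2 * π) * (21 * L * gaussPoly testPoly L / Real.sinh (L / 2)) := by
  have hs0 : 0 < Real.sinh (L / 2) := Real.sinh_pos_iff.2 (by linarith)
  have hs : Real.sinh (L / 2) ≤ 3.512 := by
    have e1 : Real.exp 0.98425 ≤ 2.6759 := by
      refine (Real.exp_bound' (n := 9) (by norm_num) (by norm_num) (by norm_num)).trans ?_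
      norm_num [Finset.sum_range_succ, Nat.factorial]
    have e2 : Real.exp 1.9685 ≤ 7.1605 := by
      rw [show (1.9685 : ℝ) = 0.98425 + 0.98425 by norm_num, Real.exp_add]
      nlinarith [Real.exp_pos 0.98425]
    have e3 : 0.1396 ≤ Real.exp (-1.9685) := by
      rw [Real.exp_neg]
      refine le_inv_of_le_inv₀ (Real.exp_pos _) (e2.trans (by norm_num))
    have := Real.sinh_le_sinh.2 (by linarith : L / 2 ≤ 1.9685)
    rw [Real.sinh_eq 1.9685] at this
    linarith
  have hp : √(2 * π) ≤ 2.5067 :=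
    Real.sqrt_le_iff.2 ⟨by norm_num, by nlinarith [Real.pi_lt_d4]⟩
  have hf : 4.16 ≤ gaussPoly testPoly L := by
    rw [gaussPoly_testPoly]
    have e : 0.0004307 ≤ Real.exp (-L ^ 2 / 2) := by
      have e1 : Real.exp 0.96875 ≤ 2.63466 := by
        refine (Real.exp_bound' (n := 10) (by norm_num) (by norm_num) (by norm_num)).trans ?_
        norm_num [Finset.sum_range_succ, Nat.factorial]
      have e2 : Real.exp 7.75 ≤ 2.63466 ^ 8 := by
        rw [show (7.75 : ℝ) = (8 : ℕ) * 0.96875 by norm_num, Real.exp_nat_mul]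
        gcongr
      have e3 : Real.exp (-7.75) ≤ Real.exp (-L ^ 2 / 2) := Real.exp_le_exp.2 (by nlinarith)
      refine le_trans ?_ e3
      rw [Real.exp_neg]
      exact le_inv_of_le_inv₀ (Real.exp_pos _) (e2.trans (by norm_num))
    have hu : 9660 ≤ (L ^ 2) ^ 3 + 277 / 20 * (L ^ 2) ^ 2 + 3376 / 25 * L ^ 2 + 26971 / 50 := by
      calc (9660 : ℝ) ≤ (3.935 ^ 2) ^ 3 + 277 / 20 * (3.935 ^ 2) ^ 2 + 3376 / 25 * 3.935 ^ 2 +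
            26971 / 50 := by norm_num
        _ ≤ _ := by gcongr
    nlinarith
  calc (38.9 : ℝ) ≤ 1 / 2.5067 * (21 * 3.935 * 4.16 / 3.512) := by norm_num
    _ ≤ _ := by gcongr

theorem stmt_5 :
    ∃ (u : Polynomial ℝ) (c : ℝ), 0 < c ∧
      (let f : ℝ → ℝ := gaussPoly u
      let fhat : ℝ → ℝ := evenFT f
      let L₁ : ℝ := 8 * Real.arccosh (1 / 2 + Real.cos (2 * π / 7))
      let L₂ : ℝ := 6 * Real.arccosh (8 * Real.cos (π / 7) ^ 4 - 6 * Real.cos (π / 7) ^ 2 + 1)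
      (∀ x : ℝ, (3.9359 : ℝ) ≤ x → f x ≥ 0) ∧
      (∀ lam : ℝ, lam ∈ Set.Icc (2.575 : ℝ) 5.5 → fhat (Real.sqrt (lam - 1 / 4)) ≤ c) ∧
      (∀ lam : ℝ, (5.5 : ℝ) ≤ lam → fhat (Real.sqrt (lam - 1 / 4)) ≤ 0) ∧
      (1 / c) *
          (4 * (∫ ξ in Set.Ioi (0 : ℝ), ξ * fhat ξ * Real.tanh (π * ξ))
            + (1 / Real.sqrt (2 * π)) * (21 * L₁ * f L₁ / Real.sinh (L₁ / 2) + 28 * L₂ * f L₂ / Real.sinh (L₂ / 2))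
            - (1 / Real.sqrt (2 * π)) * ∫ x : ℝ, f x * Real.cosh (x / 2)) > 7) := by
  have hc0 := Real.exp_pos (-1.1625)
  refine ⟨testPoly, 2.925 * 9.475 ^ 2 * Real.exp (-1.1625), by positivity, ?_⟩
  intro f fhat L₁ L₂
  refine ⟨fun x _ => gaussPoly_testPoly_nonneg x, ?_, ?_, ?_⟩
  · rintro lam ⟨h1, h2⟩
    change evenFT (gaussPoly testPoly) _ ≤ _
    rw [evenFT_testPoly, Real.sq_sqrt (by linarith)]
    have ha : 0 ≤ 21 / 4 - (lam - 1 / 4) := by linarith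
    have hb : (lam - 1 / 4 - 59 / 5) ^ 2 ≤ 9.475 ^ 2 := by nlinarith
    gcongr <;> linarith
  · intro lam h
    change evenFT (gaussPoly testPoly) _ ≤ _
    rw [evenFT_testPoly, Real.sq_sqrt (by linarith)]
    have ha : 21 / 4 - (lam - 1 / 4) ≤ 0 := by linarith
    exact mul_nonpos_of_nonpos_of_nonneg
      (mul_nonpos_of_nonpos_of_nonneg ha (sq_nonneg _)) (Real.exp_pos _).le
  · have hT := integral_evenFT_testPoly_tanh
    have hL := systole_term_ge systole_mem.1 systole_mem.2
    have hL2 : 0 ≤ 1 / √(2 * π) * (28 * L₂ * f L₂ / Real.sinh (L₂ / 2)) :=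
      mul_nonneg (by positivity) (mul_div_sinh_half_nonneg L₂ (gaussPoly_testPoly_nonneg L₂))
    have hE : 1 / √(2 * π) * ∫ x : ℝ, f x * Real.cosh (x / 2) =
        11 / 2 * (241 / 20) ^ 2 * Real.exp (1 / 8) := by
      have hp : √(2 * π) ≠ 0 := by positivity
      rw [integral_testPoly_cosh]
      field_simp
    rw [gt_iff_lt, one_div, ← div_eq_inv_mul, lt_div_iff₀ (by positivity), hE, mul_add]
    have := exp_neg_one_point_le
    have := exp_one_eighth_le
    change _ ≤ ∫ ξ in Ioi (0 : ℝ), ξ * fhat ξ * Real.tanh (π * ξ) at hT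
    change _ ≤ 1 / √(2 * π) * (21 * L₁ * f L₁ / Real.sinh (L₁ / 2)) at hL
    linarith
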